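/- arXiv:1707.04783 — 2 statements merged into one kernel-verified Lean document; each statement's English description precedes it below -/
import Mathlib

section
/- Let 0 < j < 3^n − 1 with ternary digits j_i. Suppose j ∈ S_1, {j_0, j_{(n−k) mod n}} = {1, 2}, and {j_1, j_{(1−k) mod n}} = {0, 1}. If |A ∩ {n−k, n−k+1, …, n−1}| is even, then (j_1, j_0) = (1, 2); otherwise (j_1, j_0) = (0, 1). -/
/-- The `i`-th ternary digit (indices read modulo `n`) of the residue of `j` modulo `3^n - 1`. -/
def dig (n : ℕ) (j : ℤ) (i : ℕ) : ℕ :=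
  ((j % ((3 : ℤ) ^ n - 1)).toNat / 3 ^ (i % n)) % 3

/-- The ternary weight of (the residue modulo `3^n - 1` of) `j`. -/
def wt (n : ℕ) (j : ℤ) : ℕ := ∑ i ∈ Finset.range n, dig n j i

/-- `d = (3^k + 1)/2`. -/
def cmD (k : ℕ) : ℤ := ((3 : ℤ) ^ k + 1) / 2

/-- The set `S_1`. -/
def S1 (n k : ℕ) : Set ℤ :=
  {j | 0 < j ∧ j < 3 ^ n - 1 ∧
    wt n j + wt n (3 ^ k * j) = wt n ((3 ^ k + 1) * j) + 2 ∧
    2 * wt n (-(j * cmD k)) = wt n (-((3 ^ k + 1) * j))}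
/-- The set `A = { ik mod n : 0 ≤ i ≤ w-1 }`. -/
def Aset (n k w : ℕ) : Finset ℕ := (Finset.range w).image (fun i => i * k % n)

open Finset in
theorem sum_mul_pow_lt {n : ℕ} {e : ℕ → ℕ} (he : ∀ i < n, e i ≤ 2) :
    ∑ i ∈ range n, e i * 3 ^ i < 3 ^ n := by
  induction n with
  | zero => simp
  | succ n ih =>
    have h1 := ih fun i hi => he i (by omega)
    have h2 : e n * 3 ^ n ≤ 2 * 3 ^ n := Nat.mul_le_mul_right _ (he n (by omega))
    rw [sum_range_succ, pow_succ]
    omega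

open Finset in
theorem sum_mul_pow_div_mod {n : ℕ} {e : ℕ → ℕ} (he : ∀ i < n, e i ≤ 2) {m : ℕ} (hm : m < n) :
    (∑ i ∈ range n, e i * 3 ^ i) / 3 ^ m % 3 = e m := by
  induction n generalizing e m with
  | zero => omega
  | succ n ih =>
    have h0 := he 0 (by omega)
    have hsum : ∑ i ∈ range (n + 1), e i * 3 ^ i =
        3 * ∑ i ∈ range n, e (i + 1) * 3 ^ i + e 0 := by
      rw [sum_range_succ', mul_sum]
      congr 1
      · exact sum_congr rfl fun i _ => by ring
      · simp
    rw [hsum]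
    rcases m with _ | m
    · rw [pow_zero, Nat.div_one]
      omega
    · rw [pow_succ', ← Nat.div_div_eq_div_mul]
      have : (3 * ∑ i ∈ range n, e (i + 1) * 3 ^ i + e 0) / 3 =
          ∑ i ∈ range n, e (i + 1) * 3 ^ i := by omega
      rw [this]
      exact ih (e := fun i => e (i + 1)) (fun i hi => he (i + 1) (by omega)) (by omega)

open Finset in
theorem sum_div_mod_mul_pow (n x : ℕ) :
    ∑ i ∈ range n, (x / 3 ^ i % 3) * 3 ^ i = x % 3 ^ n := by
  induction n with
  | zero => simp [Nat.mod_one]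
  | succ n ih => rw [sum_range_succ, ih, Nat.mod_pow_succ, mul_comm]

theorem three_pow_sub_one_pos {n : ℕ} (hn : 0 < n) : (0 : ℤ) < 3 ^ n - 1 := by
  have : (1 : ℤ) < 3 ^ n := one_lt_pow₀ (by norm_num) hn.ne'
  omega

theorem dig_le_two (n : ℕ) (x : ℤ) (i : ℕ) : dig n x i ≤ 2 := by
  unfold dig
  omega

theorem dig_add_self (n : ℕ) (x : ℤ) (i : ℕ) : dig n x (i + n) = dig n x i := by
  simp [dig]

theorem dig_mod (n : ℕ) (x : ℤ) (i : ℕ) : dig n x (i % n) = dig n x i := by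
  simp [dig]

open Finset in
theorem sum_dig_mul_pow {n : ℕ} (hn : 0 < n) (x : ℤ) :
    ((∑ i ∈ range n, dig n x i * 3 ^ i : ℕ) : ℤ) = x % (3 ^ n - 1) := by
  have hN := three_pow_sub_one_pos hn
  have h0 := Int.emod_nonneg x hN.ne'
  have h1 := Int.emod_lt_of_pos x hN
  have hlt : (x % (3 ^ n - 1)).toNat < 3 ^ n := by
    zify
    rw [Int.toNat_of_nonneg h0]
    omega
  have : ∑ i ∈ range n, dig n x i * 3 ^ i = (x % (3 ^ n - 1)).toNat := by
    rw [← Nat.mod_eq_of_lt hlt, ← sum_div_mod_mul_pow]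
    refine sum_congr rfl fun i hi => ?_
    rw [dig, Nat.mod_eq_of_lt (mem_range.1 hi)]
  rw [this, Int.toNat_of_nonneg h0]

theorem wt_congr {n : ℕ} {x y : ℤ} (h : x ≡ y [ZMOD 3 ^ n - 1]) : wt n x = wt n y := by
  unfold wt dig
  rw [h]

/-- Carrying three units from position `i` to position `i + 1`, cyclically. -/
theorem exists_carry {n : ℕ} {e : ℕ → ℕ} {i : ℕ} (hi : i < n) (he : 3 ≤ e i) :
    ∃ e' : ℕ → ℕ, (∀ m, e' m + (if i = m then 3 else 0) = e m + if (i + 1) % n = m then 1 else 0) ∧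
      ∑ m ∈ Finset.range n, e' m + 2 = ∑ m ∈ Finset.range n, e m ∧
      ∑ m ∈ Finset.range n, e' m * 3 ^ m + 3 ^ (i + 1) =
        ∑ m ∈ Finset.range n, e m * 3 ^ m + 3 ^ ((i + 1) % n) := by
  have hmod : (i + 1) % n < n := Nat.mod_lt _ (by omega)
  let e' : ℕ → ℕ := fun m => (e m + if (i + 1) % n = m then 1 else 0) - if i = m then 3 else 0
  have hrel : ∀ m, e' m + (if i = m then 3 else 0) =
      e m + if (i + 1) % n = m then 1 else 0 := by
    intro m
    apply Nat.sub_add_cancel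
    by_cases h : i = m
    · subst h
      simp only [if_true]
      omega
    · simp [h]
  refine ⟨e', hrel, ?_, ?_⟩
  · have := Finset.sum_congr (rfl : Finset.range n = Finset.range n) fun m _ => hrel m
    rw [Finset.sum_add_distrib, Finset.sum_add_distrib, Finset.sum_ite_eq, Finset.sum_ite_eq,
      if_pos (Finset.mem_range.2 hi), if_pos (Finset.mem_range.2 hmod)] at this
    omega
  · have := Finset.sum_congr (rfl : Finset.range n = Finset.range n)
      fun m _ => congrArg (· * 3 ^ m) (hrel m)
    simp only [add_mul, ite_mul, zero_mul, Finset.sum_add_distrib, Finset.sum_ite_eq,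
      Finset.mem_range, hi, hmod, if_true, one_mul] at this
    rw [pow_succ]
    omega

theorem pow_succ_mod_modEq {n i : ℕ} (hi : i < n) :
    (3 : ℤ) ^ ((i + 1) % n) ≡ 3 ^ (i + 1) [ZMOD 3 ^ n - 1] := by
  rcases Nat.lt_or_ge (i + 1) n with h | h
  · rw [Nat.mod_eq_of_lt h]
  · obtain rfl : i + 1 = n := by omega
    rw [Nat.mod_self, pow_zero]
    exact (Int.modEq_iff_dvd).2 dvd_rfl

theorem wt_le_sum {n : ℕ} {x : ℤ} {e : ℕ → ℕ}
    (hx : x ≡ ((∑ i ∈ Finset.range n, e i * 3 ^ i : ℕ) : ℤ) [ZMOD 3 ^ n - 1]) :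
    wt n x ≤ ∑ i ∈ Finset.range n, e i := by
  induction hs : ∑ i ∈ Finset.range n, e i using Nat.strong_induction_on generalizing e with
  | _ s ih =>
    by_cases he : ∀ i < n, e i ≤ 2
    · rw [wt_congr hx, ← hs]
      have hlt := sum_mul_pow_lt he
      refine Finset.sum_le_sum fun i hi => ?_
      have hi' := Finset.mem_range.1 hi
      rw [dig, Nat.mod_eq_of_lt hi']
      rcases Nat.lt_or_ge (∑ i ∈ Finset.range n, e i * 3 ^ i + 1) (3 ^ n) with h | h
      · rw [Int.emod_eq_of_lt (by positivity) (by zify at h; push_cast; omega), Int.toNat_natCast,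
          sum_mul_pow_div_mod he hi']
      · have : ((∑ i ∈ Finset.range n, e i * 3 ^ i : ℕ) : ℤ) = 3 ^ n - 1 := by
          have : ∑ i ∈ Finset.range n, e i * 3 ^ i + 1 = 3 ^ n := by omega
          zify at this
          push_cast
          omega
        rw [this, Int.emod_self]
        simp
    · push Not at he
      obtain ⟨i, hi, h3⟩ := he
      obtain ⟨e', -, hsum, hval⟩ := exists_carry hi h3
      have := ih _ (by omega) (e := e') (hx.trans ?_) rfl
      · omega
      · have hp := pow_succ_mod_modEq hi
        zify at hval
        have := (Int.ModEq.refl (∑ m ∈ Finset.range n, (e m : ℤ) * 3 ^ m)).add hp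
        rw [← hval] at this
        push_cast
        exact (Int.ModEq.add_right_cancel' _ this).symm

/-- A digit expansion of minimal weight needs no carries. -/
theorem le_two_of_sum_le_wt {n : ℕ} {x : ℤ} {e : ℕ → ℕ}
    (hx : x ≡ ((∑ i ∈ Finset.range n, e i * 3 ^ i : ℕ) : ℤ) [ZMOD 3 ^ n - 1])
    (hw : ∑ i ∈ Finset.range n, e i ≤ wt n x) {i : ℕ} (hi : i < n) : e i ≤ 2 := by
  by_contra! h3
  obtain ⟨e', -, hsum, hval⟩ := exists_carry hi h3
  have := wt_le_sum (e := e') (hx.trans ?_)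
  · omega
  · have hp := pow_succ_mod_modEq hi
    zify at hval
    have := (Int.ModEq.refl (∑ m ∈ Finset.range n, (e m : ℤ) * 3 ^ m)).add hp
    rw [← hval] at this
    push_cast
    exact (Int.ModEq.add_right_cancel' _ this).symm

theorem pow_mul_sum_eq {n k : ℕ} (hkn : k ≤ n) {a : ℕ → ℕ} (ha : ∀ i, a (i + n) = a i) :
    (3 : ℤ) ^ k * ((∑ i ∈ Finset.range n, a i * 3 ^ i : ℕ) : ℤ) =
      ((∑ i ∈ Finset.range n, a (i + (n - k)) * 3 ^ i : ℕ) : ℤ) +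
        (3 ^ n - 1) * ((∑ i ∈ Finset.range k, a (n - k + i) * 3 ^ i : ℕ) : ℤ) := by
  obtain ⟨l, rfl⟩ := Nat.exists_eq_add_of_le' hkn
  rw [Nat.add_sub_cancel]
  have h1 : ∑ i ∈ Finset.range (l + k), a i * 3 ^ i =
      ∑ i ∈ Finset.range l, a i * 3 ^ i + 3 ^ l * ∑ i ∈ Finset.range k, a (l + i) * 3 ^ i := by
    rw [Finset.sum_range_add, Finset.mul_sum]
    congr 1
    exact Finset.sum_congr rfl fun i _ => by ring
  have h2 : ∑ i ∈ Finset.range (l + k), a (i + l) * 3 ^ i =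
      ∑ i ∈ Finset.range k, a (l + i) * 3 ^ i + 3 ^ k * ∑ i ∈ Finset.range l, a i * 3 ^ i := by
    rw [add_comm l k, Finset.sum_range_add, Finset.mul_sum]
    congr 1
    · exact Finset.sum_congr rfl fun i _ => by rw [add_comm]
    · refine Finset.sum_congr rfl fun i _ => ?_
      rw [show k + i + l = i + (l + k) by ring, ha]
      ring
  rw [h1, h2]
  push_cast
  ring

theorem sum_range_add_period {n c : ℕ} (hc : c ≤ n) {a : ℕ → ℕ} (ha : ∀ i, a (i + n) = a i) :
    ∑ i ∈ Finset.range n, a (i + c) = ∑ i ∈ Finset.range n, a i := by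
  obtain ⟨l, rfl⟩ := Nat.exists_eq_add_of_le' hc
  rw [Finset.sum_range_add (fun i => a (i + c)), add_comm l c, Finset.sum_range_add a, add_comm]
  congr 1
  · refine Finset.sum_congr rfl fun i _ => ?_
    rw [← ha i]
    congr 1
    ring
  · exact Finset.sum_congr rfl fun i _ => by rw [add_comm]

theorem pow_mul_modEq {n k : ℕ} (hn : 0 < n) (hkn : k ≤ n) (x : ℤ) :
    3 ^ k * x ≡ ((∑ i ∈ Finset.range n, dig n x (i + (n - k)) * 3 ^ i : ℕ) : ℤ)
      [ZMOD 3 ^ n - 1] := by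
  have h := pow_mul_sum_eq hkn (dig_add_self n x)
  rw [sum_dig_mul_pow hn] at h
  refine ((Int.mod_modEq x _).symm.mul_left (3 ^ k)).trans ?_
  rw [h]
  exact (Int.modEq_iff_dvd).2
    ⟨-((∑ i ∈ Finset.range k, dig n x (n - k + i) * 3 ^ i : ℕ) : ℤ), by ring⟩

theorem wt_pow_mul_le {n k : ℕ} (hn : 0 < n) (hkn : k ≤ n) (x : ℤ) :
    wt n (3 ^ k * x) ≤ wt n x :=
  (wt_le_sum (pow_mul_modEq hn hkn x)).trans
    (sum_range_add_period (Nat.sub_le n k) (dig_add_self n x)).le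

theorem wt_le_wt_pow_mul {n k : ℕ} (hn : 0 < n) (hkn : k ≤ n) (x : ℤ) :
    wt n x ≤ wt n (3 ^ k * x) := by
  refine le_trans (le_of_eq (wt_congr ?_)) (wt_pow_mul_le hn (Nat.sub_le n k) (3 ^ k * x))
  rw [← mul_assoc, ← pow_add, Nat.sub_add_cancel hkn]
  exact (Int.modEq_iff_dvd).2 ⟨x, by ring⟩

/-- If `e + 2 u` represents `3 ^ n - 1`, with `e ≤ 2` and `u ≤ 1`, then all digits of `e` are even. -/
theorem even_of_sum_add_two_mul_sum {n : ℕ} {e u : ℕ → ℕ} (he : ∀ i < n, e i ≤ 2)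
    (hu : ∀ i < n, u i ≤ 1)
    (h : ∑ i ∈ Finset.range n, e i * 3 ^ i + 2 * ∑ i ∈ Finset.range n, u i * 3 ^ i + 1 = 3 ^ n)
    {i : ℕ} (hi : i < n) : Even (e i) := by
  have h2 : ∀ m : ℕ, ∑ i ∈ Finset.range m, 2 * 3 ^ i + 1 = 3 ^ m := by
    intro m
    induction m with
    | zero => simp
    | succ m ih => rw [Finset.sum_range_succ, pow_succ]; omega
  have h3 : ∑ i ∈ Finset.range n, (2 - 2 * u i) * 3 ^ i +
      2 * ∑ i ∈ Finset.range n, u i * 3 ^ i = ∑ i ∈ Finset.range n, 2 * 3 ^ i := by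
    rw [Finset.mul_sum, ← Finset.sum_add_distrib]
    refine Finset.sum_congr rfl fun i hi => ?_
    have := hu i (Finset.mem_range.1 hi)
    rw [← mul_assoc, ← add_mul]
    congr 1
    omega
  have h4 : ∑ i ∈ Finset.range n, e i * 3 ^ i =
      ∑ i ∈ Finset.range n, (2 - 2 * u i) * 3 ^ i := by
    have := h2 n
    omega
  have h5 := sum_mul_pow_div_mod he hi
  rw [h4, sum_mul_pow_div_mod (e := fun i => 2 - 2 * u i) (fun i _ => by omega) hi] at h5
  have := hu i hi
  rw [← h5, Nat.even_iff]
  omega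

theorem two_mul_cmD (k : ℕ) : 2 * cmD k = 3 ^ k + 1 := by
  have : Odd ((3 : ℤ) ^ k) := Odd.pow (by decide)
  obtain ⟨m, hm⟩ := this
  unfold cmD
  omega

/-- The digits of an element of `S1` whose carry sits at position `0`: all digit sums away from
positions `0` and `1` are even, and the top `k` digits have odd sum. -/
theorem S1_parity {n k : ℕ} (hn : 2 ≤ n) (hkn : k < n) {j : ℤ}
    (hj : j ∈ S1 n k) (h0 : dig n j 0 + dig n j (n - k) = 3) :
    (∀ i < n, i ≠ 0 → i ≠ 1 → Even (dig n j i + dig n j (i + (n - k)))) ∧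
      Odd (∑ i ∈ Finset.range k, dig n j (n - k + i)) := by
  obtain ⟨hj0, hjN, hwt, hhalf⟩ := hj
  have hn0 : 0 < n := by omega
  have hN := three_pow_sub_one_pos hn0
  have hjsum := sum_dig_mul_pow hn0 j
  rw [Int.emod_eq_of_lt hj0.le hjN] at hjsum
  have hrot := pow_mul_sum_eq hkn.le (dig_add_self n j)
  rw [hjsum] at hrot
  set q := ∑ i ∈ Finset.range k, dig n j (n - k + i) * 3 ^ i with hq
  -- the digitwise sum, after the carry at position `0`
  obtain ⟨e, hrel, hsum, hval⟩ := exists_carry (n := n) (i := 0)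
    (e := fun i => dig n j i + dig n j (i + (n - k))) hn0 (by simp [h0])
  simp only [add_mul, Finset.sum_add_distrib, zero_add, Nat.mod_eq_of_lt (by omega : 1 < n)]
    at hrel hsum hval
  rw [sum_range_add_period (Nat.sub_le n k) (dig_add_self n j)] at hsum
  have hV : (3 ^ k + 1) * j = ((∑ i ∈ Finset.range n, e i * 3 ^ i : ℕ) : ℤ) + (3 ^ n - 1) * q := by
    rw [Nat.add_right_cancel hval, Nat.cast_add, hjsum]
    linear_combination hrot
  have he : ∀ i < n, e i ≤ 2 := by
    intro i hi
    refine le_two_of_sum_le_wt (x := (3 ^ k + 1) * j) ?_ ?_ hi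
    · rw [hV]
      exact (Int.modEq_iff_dvd).2 ⟨-q, by ring⟩
    · have := wt_le_wt_pow_mul hn0 hkn.le j
      unfold wt at *
      omega
  -- the digits of `-j d` are `0` or `1`
  set u := dig n (-(j * cmD k)) with hu_def
  have hU := sum_dig_mul_pow hn0 (-(j * cmD k))
  have hu : ∀ i < n, u i ≤ 1 := by
    intro i hi
    have := le_two_of_sum_le_wt (x := -((3 ^ k + 1) * j)) (e := fun i => 2 * u i) ?_ ?_ hi
    · simpa using this
    · simp only [mul_assoc, ← Finset.mul_sum]
      rw [Nat.cast_mul, hU, ← two_mul_cmD,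
        show -(2 * cmD k * j) = ((2 : ℕ) : ℤ) * -(j * cmD k) by push_cast; ring]
      exact (Int.mod_modEq _ _).symm.mul_left _
    · rw [← Finset.mul_sum, ← hhalf]
      rfl
  have he0 : e 0 = 0 := by
    have := hrel 0
    simp at this
    omega
  have he1 : 1 ≤ e 1 := by
    have := hrel 1
    simp at this
    omega
  set V := ∑ i ∈ Finset.range n, e i * 3 ^ i with hVdef
  set U := ∑ i ∈ Finset.range n, u i * 3 ^ i with hUdef
  have hVpos : 0 < V := by
    have : e 1 * 3 ^ 1 ≤ V :=
      Finset.single_le_sum (f := fun i => e i * 3 ^ i) (fun _ _ => Nat.zero_le _)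
        (Finset.mem_range.2 (by omega))
    omega
  have hVlt : V + 1 < 3 ^ n := by
    have hlt := sum_mul_pow_lt he
    have hne : V + 1 ≠ 3 ^ n := by
      intro h
      have h3 : 3 ∣ V := Finset.dvd_sum fun i _ => by
        rcases i with _ | i
        · simp [he0]
        · exact Dvd.dvd.mul_left (dvd_pow_self 3 (by omega)) _
      have h3' : 3 ∣ 3 ^ n := dvd_pow_self 3 (by omega)
      omega
    omega
  have hUle : 2 * U < 3 ^ n := by
    have := sum_mul_pow_lt (n := n) (e := fun i => 2 * u i) fun i hi => by
      have := hu i hi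
      omega
    simpa only [mul_assoc, ← Finset.mul_sum] using this
  obtain ⟨t, ht⟩ : ((3 : ℤ) ^ n - 1) ∣ (U : ℤ) + j * cmD k := by
    rw [hU]
    have := (Int.modEq_iff_dvd).1 (Int.mod_modEq (-(j * cmD k)) (3 ^ n - 1)).symm
    simpa using this
  have hdvd : (V : ℤ) + 2 * U = (3 ^ n - 1) * (2 * t - q) := by
    have := two_mul_cmD k
    linear_combination 2 * ht - hV - j * this
  have hone : 2 * t - q = 1 := by
    zify at hVpos hVlt hUle
    have h1 : 0 < 2 * t - q := by
      by_contra! h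
      nlinarith
    have h2 : 2 * t - q < 2 := by
      by_contra! h
      nlinarith
    omega
  rw [hone] at hdvd
  have hVU : V + 2 * U + 1 = 3 ^ n := by
    zify
    linarith
  refine ⟨fun i hi hi0 hi1 => ?_, ?_⟩
  · have := even_of_sum_add_two_mul_sum he hu hVU hi
    have hr := hrel i
    rw [if_neg (Ne.symm hi0), if_neg (Ne.symm hi1)] at hr
    rw [add_zero, add_zero] at hr
    rwa [← hr]
  · have hqodd : Odd q := by
      rw [Nat.odd_iff]
      omega
    rw [hq] at hqodd
    have : ∀ i, (dig n j (n - k + i) * 3 ^ i) % 2 = dig n j (n - k + i) % 2 := by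
      intro i
      rw [Nat.mul_mod, Nat.pow_mod]
      simp
    rw [Nat.odd_iff, Finset.sum_nat_mod] at hqodd ⊢
    simpa only [this] using hqodd

/-- Parity is constant along the orbit of `0` under addition of `k`, before and after `1`. -/
theorem parity_on_orbit {n k w : ℕ} (hkn : k < n) (hgcd : Nat.gcd n k = 1)
    (hwn : w < n) (hwk : w * k ≡ 1 [MOD n]) {a : ℕ → ℕ} (ha : ∀ i, a (i % n) = a i)
    (hpar : ∀ i < n, i ≠ 0 → i ≠ 1 → Even (a i + a (i + (n - k)))) :
    (∀ t < w, a (t * k) % 2 = a 0 % 2) ∧ ∀ t, w ≤ t → t < n → a (t * k) % 2 = a 1 % 2 := by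
  have hinj : ∀ s t, s < n → t < n → s * k ≡ t * k [MOD n] → s = t := fun s t hs ht h =>
    (Nat.ModEq.cancel_right_of_coprime hgcd h).eq_of_lt_of_lt hs ht
  have ha' : ∀ {s t}, s ≡ t [MOD n] → a s = a t := fun {s t} h => by rw [← ha s, h, ha]
  have step : ∀ t, t + 1 < n → t + 1 ≠ w → a ((t + 1) * k) % 2 = a (t * k) % 2 := by
    intro t ht htw
    have hlt : (t + 1) * k % n < n := Nat.mod_lt _ (by omega)
    have h0 : (t + 1) * k % n ≠ 0 := fun h => by
      have := hinj (t + 1) 0 ht (by omega) (by simpa [Nat.ModEq] using h)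
      omega
    have h1 : (t + 1) * k % n ≠ 1 := fun h =>
      htw (hinj (t + 1) w ht hwn (Nat.ModEq.trans
        (by rw [Nat.ModEq, h, Nat.mod_eq_of_lt (by omega)]) hwk.symm))
    have h := hpar _ hlt h0 h1
    have h2 : a ((t + 1) * k % n + (n - k)) = a (t * k) := by
      apply ha'
      calc (t + 1) * k % n + (n - k) ≡ (t + 1) * k + (n - k) [MOD n] :=
            (Nat.mod_modEq _ _).add_right _
        _ = t * k + n := by rw [add_mul, one_mul]; omega
        _ ≡ t * k [MOD n] := by simp [Nat.ModEq]
    rw [h2, ha, Nat.even_iff] at h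
    omega
  refine ⟨fun t => ?_, fun t hwt => ?_⟩
  · induction t with
    | zero => simp
    | succ t ih =>
      intro ht
      rw [step t (by omega) (by omega), ih (by omega)]
  · induction t, hwt using Nat.le_induction with
    | base => intro _; rw [ha' hwk]
    | succ t hwt ih =>
      intro ht
      rw [step t ht (by omega), ih (by omega)]

theorem sum_mod_two_eq_card {s A : Finset ℕ} {a : ℕ → ℕ} (hA : ∀ i ∈ s, i ∈ A → a i % 2 = 1)
    (hA' : ∀ i ∈ s, i ∉ A → a i % 2 = 0) : (∑ i ∈ s, a i) % 2 = (A ∩ s).card % 2 := by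
  have : ∀ i ∈ s, a i % 2 = if i ∈ A then 1 else 0 := by
    intro i hi
    split_ifs with h
    · exact hA i hi h
    · exact hA' i hi h
  rw [Finset.sum_nat_mod, Finset.sum_congr rfl this, Finset.sum_boole, Finset.inter_comm,
    Finset.filter_mem_eq_inter, Nat.cast_id]

theorem stmt10 (n k : ℕ) (hn : 2 ≤ n) (hkodd : Odd k) (hk0 : 0 < k) (hkn : k < n)
    (hgcd : Nat.gcd n k = 1) (w : ℕ) (hw0 : 0 < w) (hwn : w < n) (hwk : w * k ≡ 1 [MOD n])
    (j : ℤ) (hj : j ∈ S1 n k)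
    (h0 : (dig n j 0 = 1 ∧ dig n j (n - k) = 2) ∨ (dig n j 0 = 2 ∧ dig n j (n - k) = 1))
    (h1 : (dig n j 1 = 0 ∧ dig n j (n - k + 1) = 1) ∨
      (dig n j 1 = 1 ∧ dig n j (n - k + 1) = 0)) :
    (Even ((Aset n k w ∩ Finset.Ico (n - k) n).card) →
      dig n j 1 = 1 ∧ dig n j 0 = 2) ∧
    (¬ Even ((Aset n k w ∩ Finset.Ico (n - k) n).card) →
      dig n j 1 = 0 ∧ dig n j 0 = 1) := by
  have h0' : dig n j 0 + dig n j (n - k) = 3 := by omega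
  obtain ⟨hpar, hodd⟩ := S1_parity hn hkn hj h0'
  obtain ⟨hlow, hhigh⟩ := parity_on_orbit hkn hgcd hwn hwk (dig_mod n j) hpar
  have hA : ∀ i, i ∈ Aset n k w → dig n j i % 2 = dig n j 0 % 2 := by
    intro i hi
    obtain ⟨t, ht, rfl⟩ := Finset.mem_image.1 hi
    rw [dig_mod]
    exact hlow t (Finset.mem_range.1 ht)
  have hA' : ∀ i < n, i ∉ Aset n k w → dig n j i % 2 = dig n j 1 % 2 := by
    intro i hi hiA
    have hik : i * w % n * k % n = i := by
      have : i * w % n * k ≡ i [MOD n] :=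
        calc i * w % n * k ≡ i * w * k [MOD n] := (Nat.mod_modEq _ _).mul_right _
          _ = i * (w * k) := mul_assoc _ _ _
          _ ≡ i * 1 [MOD n] := hwk.mul_left _
          _ = i := mul_one i
      rw [this, Nat.mod_eq_of_lt hi]
    have hw : w ≤ i * w % n := by
      by_contra! h
      exact hiA (Finset.mem_image.2 ⟨_, Finset.mem_range.2 h, hik⟩)
    have := hhigh _ hw (Nat.mod_lt _ (by omega))
    rwa [← dig_mod, hik] at this
  have hopp : dig n j (n - k) % 2 = dig n j 1 % 2 := by
    rw [← hhigh (n - 1) (by omega) (by omega), ← dig_mod n j ((n - 1) * k)]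
    congr 1
    rw [← dig_mod]
    congr 1
    apply Nat.ModEq.add_right_cancel' k
    rw [Nat.sub_add_cancel hkn.le]
    rw [← Nat.succ_mul, Nat.succ_eq_add_one, Nat.sub_add_cancel (by omega)]
    simp [Nat.ModEq]
  have hI : ∑ i ∈ Finset.range k, dig n j (n - k + i) = ∑ i ∈ Finset.Ico (n - k) n, dig n j i := by
    rw [Finset.sum_Ico_eq_sum_range, Nat.sub_sub_self hkn.le]
  rw [hI, Nat.odd_iff] at hodd
  rw [Nat.even_iff]
  rcases h0 with ⟨h0, h2⟩ | ⟨h0, h2⟩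
  · have := sum_mod_two_eq_card (s := Finset.Ico (n - k) n) (A := Aset n k w) (a := dig n j)
      (fun i _ hi => by rw [hA i hi, h0])
      (fun i hi hiA => by rw [hA' i (Finset.mem_Ico.1 hi).2 hiA, ← hopp, h2])
    omega
  · have := sum_mod_two_eq_card (s := Finset.Ico (n - k) n) (A := Aset n k w)
      (a := fun i => dig n j i + 1)
      (fun i _ hi => by have := hA i hi; omega)
      (fun i hi hiA => by have := hA' i (Finset.mem_Ico.1 hi).2 hiA; omega)
    rw [Finset.sum_add_distrib, Finset.sum_const, Nat.card_Ico, smul_eq_mul, mul_one,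
      Nat.sub_sub_self hkn.le] at this
    rw [Nat.odd_iff] at hkodd
    omega
end

section
/- For every j ∈ S_0, σ(j)·σ(−jd) = 2^{N_2(j)+1}. -/
/-- The set `S_0`. -/
def S0 (n k : ℕ) : Set ℤ :=
  {j | 0 < j ∧ j < 3 ^ n - 1 ∧
    wt n j + wt n (3 ^ k * j) = wt n ((3 ^ k + 1) * j) ∧
    2 * wt n (-(j * cmD k)) = wt n (-((3 ^ k + 1) * j)) + 2}
/-- `N_2(j)`: the number of ternary digits of (the residue of) `j` equal to 2. -/
def N2 (n : ℕ) (j : ℤ) : ℕ := ((Finset.range n).filter (fun i => dig n j i = 2)).card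

/-- `σ(j)`: the product of the factorials of the ternary digits of (the residue of) `j`. -/
def sigmaFac (n : ℕ) (j : ℤ) : ℕ := ∏ i ∈ Finset.range n, Nat.factorial (dig n j i)

theorem sigmaFac_eq_two_pow (n : ℕ) (j : ℤ) : sigmaFac n j = 2 ^ N2 n j := by
  unfold sigmaFac N2
  rw [Finset.card_filter, ← Finset.prod_pow_eq_pow_sum]
  refine Finset.prod_congr rfl fun i _ => ?_
  have h : dig n j i < 3 := Nat.mod_lt _ (by norm_num)
  interval_cases dig n j i <;> simp

/-- Propagation of carries through the `n` lowest ternary digits of `2 * m + c`: here `c'` is the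
outgoing carry and `C` is the number of positions producing a carry. -/
theorem exists_carries_two_mul_add (m c : ℕ) (hc : c ≤ 1) (n : ℕ) :
    ∃ C c' : ℕ, (2 * m + c) / 3 ^ n = 2 * (m / 3 ^ n) + c' ∧ c' ≤ 1 ∧
      2 * ∑ i ∈ Finset.range n, m / 3 ^ i % 3 + c =
        ∑ i ∈ Finset.range n, (2 * m + c) / 3 ^ i % 3 + 2 * C + c' ∧
      ∑ i ∈ Finset.range n, (if m / 3 ^ i % 3 = 2 then 1 else 0) ≤ C ∧
      (∑ i ∈ Finset.range n, (if m / 3 ^ i % 3 = 2 then 1 else 0) = 0 → c = 0 →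
        C = 0 ∧ c' = 0) ∧
      (∑ i ∈ Finset.range n, (if m / 3 ^ i % 3 = 2 then 1 else 0) = 0 → c = 1 → c' = 1 →
        C = n) := by
  induction n with
  | zero => exact ⟨0, c, by simp [hc]⟩
  | succ n ih =>
    obtain ⟨C, c', h1, h2, h3, h4, h5, h6⟩ := ih
    refine ⟨C + (2 * (m / 3 ^ n % 3) + c') / 3, (2 * (m / 3 ^ n % 3) + c') / 3, ?_⟩
    simp only [Finset.sum_range_succ, pow_succ, ← Nat.div_div_eq_div_mul, h1]
    generalize m / 3 ^ n = x at *
    generalize ∑ i ∈ Finset.range n, (if m / 3 ^ i % 3 = 2 then 1 else 0) = N at *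
    split_ifs <;> refine ⟨?_, ?_, ?_, ?_, ?_, ?_⟩ <;> intros <;> (first | contradiction | omega)

theorem add_pow_div_pow_mod_of_lt (x : ℕ) {i n : ℕ} (h : i < n) :
    (x + 3 ^ n) / 3 ^ i % 3 = x / 3 ^ i % 3 := by
  obtain ⟨t, rfl⟩ := Nat.exists_eq_add_of_lt h
  rw [show 3 ^ (i + t + 1) = 3 ^ i * (3 * 3 ^ t) by ring,
    Nat.add_mul_div_left _ _ (by positivity), Nat.add_mul_mod_self_left]

theorem wt_eq_sum (n : ℕ) (j : ℤ) :
    wt n j = ∑ i ∈ Finset.range n, (j % ((3 : ℤ) ^ n - 1)).toNat / 3 ^ i % 3 := by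
  refine Finset.sum_congr rfl fun i hi => ?_
  rw [dig, Nat.mod_eq_of_lt (Finset.mem_range.1 hi)]

theorem N2_eq_sum (n : ℕ) (j : ℤ) :
    N2 n j = ∑ i ∈ Finset.range n,
      (if (j % ((3 : ℤ) ^ n - 1)).toNat / 3 ^ i % 3 = 2 then 1 else 0) := by
  rw [N2, Finset.card_filter]
  refine Finset.sum_congr rfl fun i hi => ?_
  rw [dig, Nat.mod_eq_of_lt (Finset.mem_range.1 hi)]

/-- If doubling `j` modulo `3 ^ n - 1` produces exactly one carry, then `j` has exactly one
ternary digit equal to `2`. -/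
theorem N2_eq_one_of_two_mul_wt_eq (n : ℕ) (hn : 2 ≤ n) (j : ℤ)
    (h : 2 * wt n j = wt n (2 * j) + 2) : N2 n j = 1 := by
  have hq : 1 < 3 ^ n := Nat.one_lt_pow (by omega) (by norm_num)
  have hqZ : (0 : ℤ) < (3 : ℤ) ^ n - 1 := by
    have : (1 : ℤ) < (3 : ℤ) ^ n := by exact_mod_cast hq
    linarith
  rw [wt_eq_sum, wt_eq_sum] at h
  rw [N2_eq_sum]
  have hr0 : 0 ≤ j % ((3 : ℤ) ^ n - 1) := Int.emod_nonneg _ hqZ.ne'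
  have hrq : j % ((3 : ℤ) ^ n - 1) < (3 : ℤ) ^ n - 1 := Int.emod_lt_of_pos _ hqZ
  have h2 : 2 * j % ((3 : ℤ) ^ n - 1) = 2 * (j % ((3 : ℤ) ^ n - 1)) % ((3 : ℤ) ^ n - 1) := by
    simp [Int.mul_emod]
  rw [h2] at h
  lift j % ((3 : ℤ) ^ n - 1) to ℕ using hr0 with m
  simp only [Int.toNat_natCast] at h ⊢
  have hm : m + 1 < 3 ^ n := by zify; linarith
  have hm0 : m / 3 ^ n = 0 := Nat.div_eq_of_lt (by omega)
  rcases lt_or_ge (2 * m + 1) (3 ^ n) with hlt | hge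
  · have hlt' : (2 * m + 1 : ℤ) < 3 ^ n := by exact_mod_cast hlt
    rw [Int.emod_eq_of_lt (by positivity) (by linarith),
      show (2 * (m : ℤ)).toNat = 2 * m by omega] at h
    obtain ⟨C, c', h1, -, h3, h4, h5, -⟩ := exists_carries_two_mul_add m 0 (by norm_num) n
    rw [hm0, Nat.div_eq_of_lt (by omega)] at h1
    simp only [add_zero] at h3
    omega
  · obtain ⟨r, hr⟩ := Nat.exists_eq_add_of_le' hge
    have hrZ : (2 * m : ℤ) = r + ((3 : ℤ) ^ n - 1) := by
      have : (2 * m + 1 : ℤ) = r + 3 ^ n := by exact_mod_cast hr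
      linarith
    have hr' : (r : ℤ) < 3 ^ n - 1 := by linarith
    rw [hrZ, Int.add_emod_right, Int.emod_eq_of_lt (by positivity) hr', Int.toNat_natCast] at h
    obtain ⟨C, c', h1, -, h3, h4, -, h6⟩ := exists_carries_two_mul_add m 1 le_rfl n
    rw [hm0, hr, Nat.add_div_right _ (by positivity), Nat.div_eq_of_lt (by omega)] at h1
    rw [hr, Finset.sum_congr rfl fun i hi =>
      add_pow_div_pow_mod_of_lt r (Finset.mem_range.1 hi)] at h3
    omega

theorem stmt13 (n k : ℕ) (hn : 2 ≤ n) (hkodd : Odd k) (hk0 : 0 < k) (hkn : k < n)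
    (hgcd : Nat.gcd n k = 1) (j : ℤ) (hj : j ∈ S0 n k) :
    sigmaFac n j * sigmaFac n (-(j * cmD k)) = 2 ^ (N2 n j + 1) := by
  obtain ⟨-, -, -, h⟩ := hj
  have hd : 2 * cmD k = 3 ^ k + 1 :=
    Int.mul_ediv_cancel' (even_iff_two_dvd.1 ((Odd.pow (by decide)).add_odd odd_one))
  rw [show -((3 ^ k + 1) * j) = 2 * -(j * cmD k) by rw [← hd]; ring] at h
  rw [sigmaFac_eq_two_pow, sigmaFac_eq_two_pow, N2_eq_one_of_two_mul_wt_eq n hn _ h,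
    pow_succ 2 (N2 n j), pow_one]
end
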